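/- Let $n\ge 1$ and let $\Omega\subset\mathbb{R}^n$ be a bounded open set. For an exponent $a:\overline\Omega\to(1,\infty)$, $L^{a(.)}(\Omega)$ is the space of measurable $u:\Omega\to\mathbb{R}$ with $\int_\Omega|u(x)|^{a(x)}\,dx<\infty$, with the Luxemburg norm $\|u\|_{L^{a(.)}(\Omega)}=\inf\{\lambda>0:\int_\Omega|u(x)/\lambda|^{a(x)}\,dx\le 1\}$. Put $$[u]_{q(.),s(.),\Omega}=\inf\Big\{\lambda>0:\int_\Omega\int_\Omega\Big|\frac{u(x)-u(y)}{\lambda}\Big|^{q(x,y)}\frac{dx\,dy}{|x-y|^{n+q(x,y)s(x,y)}}<1\Big\},$$ and let $H_0^{p(.),q(.),s(.)}(\Omega)$ be the set of Lebesgue measurable $u:\mathbb{R}^n\to\mathbb{R}$ with $u=0$ a.e. on $\mathbb{R}^n\setminus\Omega$, $u\in L^{p(.)}(\Omega)$ and $[u]_{q(.),s(.),\Omega}<\infty$, normed by $\|u\|_{L^{p(.)}(\Omega)}+[u]_{q(.),s(.),\Omega}$. Suppose $q:\overline\Omega\times\overline\Omega\to(1,\infty)$, $s:\mathbb{R}^n\times\mathbb{R}^n\to(0,1)$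 and $r:\overline\Omega\to(1,\infty)$ are continuous, $q$ and $s$ are symmetric, and that for some $x_0\in\Omega$ one has $$s(x_0,x_0)\,q(x_0,x_0)<n,\qquad \frac{n\,q(x_0,x_0)}{n-s(x_0,x_0)\,q(x_0,x_0)}<r(x_0),\qquad q^+:=\max_{\overline\Omega\times\overline\Omega}q<r(x_0).$$ Then there is $\delta>0$ with $\overline B_\delta(x_0)\subset\Omega$ such that the following holds. There are continuous exponents $p:\overline\Omega\to(1,\infty)$ with $q^+<p(x)<\min_{\overline B_\delta(x_0)}r$ for all $x\in\overline\Omega$; and for every continuous $p:\overline\Omega\to(1,\infty)$ with $p(x)<\min_{\overline B_\delta(x_0)}r$ for all $x\in\overline\Omega$ there exist a constant $C>0$ and a sequence $\{u_j\}$ in $H_0^{p(.),q(.),s(.)}(\Omega)\cap L^{r(.)}(\Omega)$ of functions supported inside $B_\delta(x_0)$ such that $\|u_j\|_{L^{p(.)}(\Omega)}+[u_j]_{q(.),s(.),\Omega}\le C$ for all $j$, while $\|u_j\|_{L^{r(.)}(\Omega)}\to+\infty$ as $j\to\infty$; in particular $H_0^{p(.),q(.),s(.)}(\Omega)$ is not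 continuously embedded into $L^{r(.)}(\Omega)$. -/

import Mathlib

open MeasureTheory Filter Topology
open scoped ENNReal

noncomputable section

/-- The modular `ϱ_{a(·)}(u) = ∫_Ω |u(x)|^{a(x)} dx`, with values in `[0,∞]`. -/
def varModular {n : ℕ} (Ω : Set (EuclideanSpace ℝ (Fin n)))
    (a u : EuclideanSpace ℝ (Fin n) → ℝ) : ℝ≥0∞ :=
  ∫⁻ x in Ω, ENNReal.ofReal (|u x| ^ a x)

/-- Membership in `L^{a(·)}(Ω)`: Lebesgue measurable on `Ω` with finite modular. -/
def MemVarLp {n : ℕ} (Ω : Set (EuclideanSpace ℝ (Fin n)))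
    (a u : EuclideanSpace ℝ (Fin n) → ℝ) : Prop :=
  AEMeasurable u (volume.restrict Ω) ∧ varModular Ω a u < ⊤

/-- The Luxemburg norm on `L^{a(·)}(Ω)`, with values in `[0,∞]`; the infimum of the empty
set is `∞`. -/
def luxNorm {n : ℕ} (Ω : Set (EuclideanSpace ℝ (Fin n)))
    (a u : EuclideanSpace ℝ (Fin n) → ℝ) : ℝ≥0∞ :=
  ⨅ (l : ℝ) (_ : 0 < l ∧ varModular Ω a (fun x => u x / l) ≤ 1), ENNReal.ofReal l

/-- The double integral
`∫_Ω ∫_Ω |u(x) - u(y)|^{q(x,y)} |x - y|^{-(n + q(x,y) s(x,y))} dx dy`, in `[0,∞]`. -/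
def gagModular {n : ℕ} (Ω : Set (EuclideanSpace ℝ (Fin n)))
    (q s : EuclideanSpace ℝ (Fin n) → EuclideanSpace ℝ (Fin n) → ℝ)
    (u : EuclideanSpace ℝ (Fin n) → ℝ) : ℝ≥0∞ :=
  ∫⁻ x in Ω, ∫⁻ y in Ω,
    ENNReal.ofReal (|u x - u y| ^ q x y / dist x y ^ ((n : ℝ) + q x y * s x y))

/-- The variable-exponent Gagliardo seminorm `[u]_{q(·),s(·),Ω}`, with values in `[0,∞]`. -/
def gagSemi {n : ℕ} (Ω : Set (EuclideanSpace ℝ (Fin n)))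
    (q s : EuclideanSpace ℝ (Fin n) → EuclideanSpace ℝ (Fin n) → ℝ)
    (u : EuclideanSpace ℝ (Fin n) → ℝ) : ℝ≥0∞ :=
  ⨅ (l : ℝ) (_ : 0 < l ∧ gagModular Ω q s (fun x => u x / l) < 1), ENNReal.ofReal l

/-- Membership in `H_0^{p(·),q(·),s(·)}(Ω)`: Lebesgue measurable on `ℝ^n`, zero a.e. outside
`Ω`, in `L^{p(·)}(Ω)`, and with finite Gagliardo seminorm. -/
def MemH0 {n : ℕ} (Ω : Set (EuclideanSpace ℝ (Fin n))) (p : EuclideanSpace ℝ (Fin n) → ℝ)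
    (q s : EuclideanSpace ℝ (Fin n) → EuclideanSpace ℝ (Fin n) → ℝ)
    (u : EuclideanSpace ℝ (Fin n) → ℝ) : Prop :=
  AEMeasurable u volume ∧ (∀ᵐ x ∂volume, x ∉ Ω → u x = 0) ∧
    MemVarLp Ω p u ∧ gagSemi Ω q s u < ⊤

/-- The norm `‖u‖_{L^{p(·)}(Ω)} + [u]_{q(·),s(·),Ω}` of `H_0^{p(·),q(·),s(·)}(Ω)`. -/
def h0Norm {n : ℕ} (Ω : Set (EuclideanSpace ℝ (Fin n))) (p : EuclideanSpace ℝ (Fin n) → ℝ)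
    (q s : EuclideanSpace ℝ (Fin n) → EuclideanSpace ℝ (Fin n) → ℝ)
    (u : EuclideanSpace ℝ (Fin n) → ℝ) : ℝ≥0∞ :=
  luxNorm Ω p u + gagSemi Ω q s u

/-- `H_0^{p(·),q(·),s(·)}(Ω)` is contained in `L^{r(·)}(Ω)`, with a bounded inclusion. -/
def H0EmbedsInVarLp {n : ℕ} (Ω : Set (EuclideanSpace ℝ (Fin n)))
    (p : EuclideanSpace ℝ (Fin n) → ℝ)
    (q s : EuclideanSpace ℝ (Fin n) → EuclideanSpace ℝ (Fin n) → ℝ)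
    (r : EuclideanSpace ℝ (Fin n) → ℝ) : Prop :=
  ∃ K : ℝ, 0 < K ∧ ∀ v : EuclideanSpace ℝ (Fin n) → ℝ, MemH0 Ω p q s v →
    MemVarLp Ω r v ∧ luxNorm Ω r v ≤ ENNReal.ofReal K * h0Norm Ω p q s v

end

/-- The radial profile `t ↦ min (t ^ κ) (t ^ (-κ)) / t ^ n`, which dominates a rescaled
fractional kernel on `ℝ^n` both near the diagonal and at infinity. -/
noncomputable def radialKernel (n : ℕ) (κ t : ℝ) : ℝ := min (t ^ κ) (t ^ (-κ)) / t ^ (n : ℝ)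

lemma measurable_radialKernel (n : ℕ) (κ : ℝ) : Measurable (radialKernel n κ) := by
  unfold radialKernel
  fun_prop

lemma integrable_radialKernel {n : ℕ} (hn : 1 ≤ n) {κ : ℝ} (hκ : 0 < κ) :
    Integrable (fun w : EuclideanSpace ℝ (Fin n) => radialKernel n κ ‖w‖) := by
  have : Nonempty (Fin n) := ⟨⟨0, hn⟩⟩
  rw [integrable_fun_norm_addHaar volume (f := radialKernel n κ), finrank_euclideanSpace_fin]
  have hn' : ((n - 1 : ℕ) : ℝ) = n - 1 := by push_cast [hn]; ring
  have key : ∀ t : ℝ, 0 < t → t ^ (n - 1) • radialKernel n κ t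
      = min (t ^ (κ - 1)) (t ^ (-κ - 1)) := by
    intro t ht
    have h1 : ∀ a : ℝ, t ^ (a - 1) = t ^ a * t⁻¹ := fun a => by
      rw [Real.rpow_sub_one ht.ne', div_eq_mul_inv]
    rw [h1, h1, ← min_mul_of_nonneg _ _ (inv_nonneg.2 ht.le), radialKernel, smul_eq_mul,
      ← Real.rpow_natCast, hn', Real.rpow_sub_one ht.ne']
    have := (Real.rpow_pos_of_pos ht (n : ℝ)).ne'
    field_simp
  have hm : Measurable fun t : ℝ => t ^ (n - 1) • radialKernel n κ t :=
    (measurable_id.pow_const _).smul (measurable_radialKernel n κ)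
  rw [← Set.Ioc_union_Ioi_eq_Ioi (zero_le_one' ℝ)]
  refine IntegrableOn.union ?_ ?_
  · have h : IntegrableOn (fun t : ℝ => t ^ (κ - 1)) (Set.Ioc 0 1) :=
      (intervalIntegrable_iff_integrableOn_Ioc_of_le zero_le_one).1
        (intervalIntegral.intervalIntegrable_rpow' (by linarith))
    refine Integrable.mono' h hm.aestronglyMeasurable ?_
    refine ae_restrict_of_forall_mem measurableSet_Ioc fun t ht => ?_
    have ht0 : 0 < t := ht.1
    rw [key t ht0, Real.norm_of_nonneg (by positivity)]
    exact min_le_left _ _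
  · have h : IntegrableOn (fun t : ℝ => t ^ (-κ - 1)) (Set.Ioi 1) :=
      integrableOn_Ioi_rpow_of_lt (by linarith) one_pos
    refine Integrable.mono' h hm.aestronglyMeasurable ?_
    refine ae_restrict_of_forall_mem measurableSet_Ioi fun t ht => ?_
    have ht0 : 0 < t := one_pos.trans ht
    rw [key t ht0, Real.norm_of_nonneg (by positivity)]
    exact min_le_right _ _

lemma lintegral_radialKernel_lt_top {n : ℕ} (hn : 1 ≤ n) {κ : ℝ} (hκ : 0 < κ) :
    ∫⁻ w : EuclideanSpace ℝ (Fin n), ENNReal.ofReal (radialKernel n κ ‖w‖) < ⊤ := by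
  have h := (integrable_radialKernel hn hκ).hasFiniteIntegral
  refine lt_of_le_of_lt (lintegral_mono fun w => ?_) h
  exact Real.ofReal_le_enorm _

lemma lintegral_radialKernel_dist {n : ℕ} (κ : ℝ) (x : EuclideanSpace ℝ (Fin n)) {ε : ℝ}
    (hε : 0 < ε) :
    ∫⁻ y, ENNReal.ofReal (radialKernel n κ (dist x y / ε)) = ENNReal.ofReal (ε ^ (n : ℝ)) *
      ∫⁻ w : EuclideanSpace ℝ (Fin n), ENNReal.ofReal (radialKernel n κ ‖w‖) := by
  set f : EuclideanSpace ℝ (Fin n) → ℝ≥0∞ := fun w => ENNReal.ofReal (radialKernel n κ ‖w‖)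
  have hf : Measurable f := ((measurable_radialKernel n κ).comp measurable_norm).ennreal_ofReal
  have h1 : ∀ y, ENNReal.ofReal (radialKernel n κ (dist x y / ε)) = f (ε⁻¹ • (y - x)) := by
    intro y
    simp only [f, norm_smul, norm_inv, Real.norm_of_nonneg hε.le]
    rw [dist_comm, dist_eq_norm, div_eq_inv_mul]
  simp_rw [h1]
  rw [lintegral_sub_right_eq_self (fun z => f (ε⁻¹ • z)) x,
    ← lintegral_map (f := f) hf (measurable_const_smul ε⁻¹),
    Measure.map_addHaar_smul volume (inv_ne_zero hε.ne'), lintegral_smul_measure,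
    finrank_euclideanSpace_fin, smul_eq_mul, inv_pow, inv_inv, abs_of_pos (by positivity),
    Real.rpow_natCast]

lemma rpow_div_rpow_le_near {n : ℕ} {ε β κ q s d t : ℝ} (hε : 0 < ε) (hε1 : ε ≤ 1)
    (hκ : 0 ≤ κ) (hκs : κ ≤ s) (hκs' : κ ≤ 1 - s) (hq : 1 ≤ q) (hβ : β * q + q * s ≤ n)
    (ht : 0 < t) (hd : 0 ≤ d) (hdt : d ≤ ε ^ (-β) * min 1 (t / ε)) :
    d ^ q / t ^ ((n : ℝ) + q * s) ≤ ε ^ (-(2 * n : ℝ)) * radialKernel n κ (t / ε) := by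
  obtain ⟨τ, hτ⟩ : ∃ τ, τ = t / ε := ⟨_, rfl⟩
  have hτ0 : 0 < τ := hτ ▸ div_pos ht hε
  have htτ : t = ε * τ := by rw [hτ]; field_simp
  rw [← hτ] at hdt ⊢
  have h1 : (min 1 τ) ^ q ≤ min (τ ^ κ) (τ ^ (-κ)) * τ ^ (q * s) := by
    rw [min_mul_of_nonneg _ _ (by positivity), ← Real.rpow_add hτ0, ← Real.rpow_add hτ0]
    rcases le_total τ 1 with h | h
    · rw [min_eq_right h]
      refine le_min ?_ ?_ <;> refine Real.rpow_le_rpow_of_exponent_ge hτ0 h ?_ <;> nlinarith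
    · rw [min_eq_left h, Real.one_rpow]
      refine le_min ?_ ?_ <;> refine Real.one_le_rpow h ?_ <;> nlinarith
  have h2 : d ^ q ≤ ε ^ (-β * q) * (min (τ ^ κ) (τ ^ (-κ)) * τ ^ (q * s)) := by
    calc d ^ q ≤ (ε ^ (-β) * min 1 τ) ^ q := Real.rpow_le_rpow hd hdt (by linarith)
      _ = ε ^ (-β * q) * (min 1 τ) ^ q := by
          rw [Real.mul_rpow (by positivity) (by positivity), ← Real.rpow_mul hε.le]
      _ ≤ _ := by gcongr
  have h3 : ε ^ (-β * q) ≤ ε ^ (-(2 * n : ℝ)) * ε ^ ((n : ℝ) + q * s) := by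
    rw [← Real.rpow_add hε]
    exact Real.rpow_le_rpow_of_exponent_ge hε hε1 (by linarith)
  have hm : 0 < min (τ ^ κ) (τ ^ (-κ)) := by positivity
  rw [div_le_iff₀ (by positivity), radialKernel, htτ, Real.mul_rpow hε.le hτ0.le,
    Real.rpow_add hτ0]
  calc d ^ q ≤ ε ^ (-β * q) * (min (τ ^ κ) (τ ^ (-κ)) * τ ^ (q * s)) := h2
    _ ≤ (ε ^ (-(2 * n : ℝ)) * ε ^ ((n : ℝ) + q * s)) *
        (min (τ ^ κ) (τ ^ (-κ)) * τ ^ (q * s)) := by gcongr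
    _ = _ := by
      have := (Real.rpow_pos_of_pos hτ0 (n : ℝ)).ne'
      field_simp

lemma rpow_div_rpow_le_far {n : ℕ} {ε β q s d t h Q : ℝ} (hε : 0 < ε) (hε1 : ε ≤ 1)
    (hh : 0 < h) (hh1 : h ≤ 1) (hs0 : 0 ≤ s) (hs1 : s ≤ 1) (hq : 0 ≤ q) (hqQ : q ≤ Q)
    (hβ : β * q ≤ n) (ht : h ≤ t) (hd : 0 ≤ d) (hdt : d ≤ ε ^ (-β)) :
    d ^ q / t ^ ((n : ℝ) + q * s) ≤ ε ^ (-(n : ℝ)) * h ^ (-((n : ℝ) + Q)) := by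
  have h1 : d ^ q ≤ ε ^ (-(n : ℝ)) := by
    calc d ^ q ≤ (ε ^ (-β)) ^ q := Real.rpow_le_rpow hd hdt hq
      _ = ε ^ (-β * q) := by rw [← Real.rpow_mul hε.le]
      _ ≤ _ := Real.rpow_le_rpow_of_exponent_ge hε hε1 (by linarith)
  have h2 : h ^ ((n : ℝ) + Q) ≤ t ^ ((n : ℝ) + q * s) := by
    calc h ^ ((n : ℝ) + Q) ≤ h ^ ((n : ℝ) + q * s) :=
          Real.rpow_le_rpow_of_exponent_ge hh hh1 (by nlinarith)
      _ ≤ _ := Real.rpow_le_rpow hh.le ht (by positivity)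
  rw [Real.rpow_neg hh.le, ← div_eq_mul_inv]
  gcongr

/-- The tent of height `ε ^ (-β)` over the ball of radius `ε` centred at `x₀`. -/
noncomputable def tent {n : ℕ} (x₀ : EuclideanSpace ℝ (Fin n)) (β ε : ℝ)
    (x : EuclideanSpace ℝ (Fin n)) : ℝ := ε ^ (-β) * max 0 (1 - dist x x₀ / ε)

section tent

variable {n : ℕ} {x₀ : EuclideanSpace ℝ (Fin n)} {β ε : ℝ}

lemma continuous_tent : Continuous (tent x₀ β ε) := by
  unfold tent
  fun_prop

lemma tent_nonneg (hε : 0 < ε) (x) : 0 ≤ tent x₀ β ε x := by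
  unfold tent
  positivity

lemma tent_le (hε : 0 < ε) (x) : tent x₀ β ε x ≤ ε ^ (-β) := by
  unfold tent
  refine mul_le_of_le_one_right (by positivity) (max_le zero_le_one ?_)
  have : 0 ≤ dist x x₀ / ε := by positivity
  linarith

lemma tent_eq_zero (hε : 0 < ε) {x} (hx : x ∉ Metric.ball x₀ ε) : tent x₀ β ε x = 0 := by
  rw [Metric.mem_ball, not_lt] at hx
  have : 1 ≤ dist x x₀ / ε := (one_le_div hε).2 hx
  rw [tent, max_eq_left (by linarith), mul_zero]

lemma le_tent (hε : 0 < ε) {x} (hx : x ∈ Metric.ball x₀ (ε / 2)) :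
    ε ^ (-β) / 2 ≤ tent x₀ β ε x := by
  rw [Metric.mem_ball] at hx
  have h : dist x x₀ / ε ≤ 1 / 2 := by rw [div_le_iff₀ hε]; linarith
  rw [tent, div_eq_mul_inv]
  gcongr
  exact le_max_of_le_right (by linarith)

lemma abs_tent_sub_tent_le (hε : 0 < ε) (x y) :
    |tent x₀ β ε x - tent x₀ β ε y| ≤ ε ^ (-β) * min 1 (dist x y / ε) := by
  rw [mul_min_of_nonneg _ _ (by positivity), mul_one]
  refine le_min ?_ ?_
  · exact abs_sub_le_of_nonneg_of_le (tent_nonneg hε x) (tent_le hε x) (tent_nonneg hε y)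
      (tent_le hε y)
  · rw [tent, tent, ← mul_sub, abs_mul, abs_of_pos (by positivity : 0 < ε ^ (-β))]
    gcongr
    rw [max_comm 0, max_comm 0]
    refine (abs_max_sub_max_le_abs _ _ _).trans ?_
    rw [sub_sub_sub_cancel_left, ← sub_div, abs_div, abs_of_pos hε]
    gcongr
    rw [abs_sub_comm]
    exact abs_dist_sub_le x y x₀

lemma tsupport_tent_subset (hε : 0 < ε) {δ : ℝ} (hεδ : ε < δ) :
    tsupport (tent x₀ β ε) ⊆ Metric.ball x₀ δ := by
  refine (closure_minimal (fun x hx => ?_) Metric.isClosed_closedBall).trans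
    (Metric.closedBall_subset_ball hεδ)
  by_contra h
  exact hx (tent_eq_zero hε fun hx' => h (Metric.ball_subset_closedBall hx'))

end tent

section modular

variable {n : ℕ} {Ω : Set (EuclideanSpace ℝ (Fin n))}

lemma abs_div_rpow_le {u l a : ℝ} (hl : 1 ≤ l) (ha : 1 ≤ a) : |u / l| ^ a ≤ l⁻¹ * |u| ^ a := by
  have hl0 : 0 < l := by linarith
  rw [abs_div, abs_of_pos hl0, Real.div_rpow (abs_nonneg _) hl0.le, div_eq_inv_mul]
  gcongr
  exact Real.self_le_rpow_of_one_le hl ha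

lemma varModular_div_le (hΩ : MeasurableSet Ω) {a : EuclideanSpace ℝ (Fin n) → ℝ}
    (ha : ∀ x ∈ Ω, 1 ≤ a x) (u : EuclideanSpace ℝ (Fin n) → ℝ) {l : ℝ} (hl : 1 ≤ l) :
    varModular Ω a (fun x => u x / l) ≤ ENNReal.ofReal l⁻¹ * varModular Ω a u := by
  have hl0 : 0 ≤ l⁻¹ := by positivity
  unfold varModular
  rw [← lintegral_const_mul' _ _ ENNReal.ofReal_ne_top]
  refine setLIntegral_mono' hΩ fun x hx => ?_
  rw [← ENNReal.ofReal_mul hl0]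
  exact ENNReal.ofReal_le_ofReal (abs_div_rpow_le hl (ha x hx))

lemma gagModular_div_le (hΩ : MeasurableSet Ω)
    {q s : EuclideanSpace ℝ (Fin n) → EuclideanSpace ℝ (Fin n) → ℝ}
    (hq : ∀ x ∈ Ω, ∀ y ∈ Ω, 1 ≤ q x y) (u : EuclideanSpace ℝ (Fin n) → ℝ) {l : ℝ}
    (hl : 1 ≤ l) :
    gagModular Ω q s (fun x => u x / l) ≤ ENNReal.ofReal l⁻¹ * gagModular Ω q s u := by
  have hl0 : 0 ≤ l⁻¹ := by positivity
  unfold gagModular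
  rw [← lintegral_const_mul' _ _ ENNReal.ofReal_ne_top]
  refine setLIntegral_mono' hΩ fun x hx => ?_
  rw [← lintegral_const_mul' _ _ ENNReal.ofReal_ne_top]
  refine setLIntegral_mono' hΩ fun y hy => ?_
  rw [← ENNReal.ofReal_mul hl0, ← mul_div_assoc, ← sub_div]
  refine ENNReal.ofReal_le_ofReal (div_le_div_of_nonneg_right ?_ (by positivity))
  exact abs_div_rpow_le hl (hq x hx y hy)

lemma ofReal_inv_mul_lt_one {C : ℝ} (hC : 0 ≤ C) {m : ℝ≥0∞} (hm : m ≤ ENNReal.ofReal C) :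
    ENNReal.ofReal (C + 1)⁻¹ * m < 1 := by
  calc ENNReal.ofReal (C + 1)⁻¹ * m ≤ ENNReal.ofReal (C + 1)⁻¹ * ENNReal.ofReal C := by gcongr
    _ = ENNReal.ofReal ((C + 1)⁻¹ * C) := (ENNReal.ofReal_mul (by positivity)).symm
    _ < 1 := by
      rw [ENNReal.ofReal_lt_one, inv_mul_lt_iff₀ (by positivity)]
      linarith

lemma luxNorm_le_of_varModular_le (hΩ : MeasurableSet Ω) {a : EuclideanSpace ℝ (Fin n) → ℝ}
    (ha : ∀ x ∈ Ω, 1 ≤ a x) {u : EuclideanSpace ℝ (Fin n) → ℝ} {C : ℝ} (hC : 0 ≤ C)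
    (h : varModular Ω a u ≤ ENNReal.ofReal C) : luxNorm Ω a u ≤ ENNReal.ofReal (C + 1) :=
  iInf₂_le (C + 1) ⟨by linarith, ((varModular_div_le hΩ ha u (by linarith)).trans_lt
    (ofReal_inv_mul_lt_one hC h)).le⟩

lemma gagSemi_le_of_gagModular_le (hΩ : MeasurableSet Ω)
    {q s : EuclideanSpace ℝ (Fin n) → EuclideanSpace ℝ (Fin n) → ℝ}
    (hq : ∀ x ∈ Ω, ∀ y ∈ Ω, 1 ≤ q x y) {u : EuclideanSpace ℝ (Fin n) → ℝ} {C : ℝ}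
    (hC : 0 ≤ C) (h : gagModular Ω q s u ≤ ENNReal.ofReal C) :
    gagSemi Ω q s u ≤ ENNReal.ofReal (C + 1) :=
  iInf₂_le (C + 1) ⟨by linarith, (gagModular_div_le hΩ hq u (by linarith)).trans_lt
    (ofReal_inv_mul_lt_one hC h)⟩

lemma le_luxNorm_of_one_lt_varModular (hΩ : MeasurableSet Ω)
    {a : EuclideanSpace ℝ (Fin n) → ℝ} (ha : ∀ x ∈ Ω, 0 ≤ a x)
    {u : EuclideanSpace ℝ (Fin n) → ℝ} {l : ℝ} (h : 1 < varModular Ω a (fun x => u x / l)) :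
    ENNReal.ofReal l ≤ luxNorm Ω a u := by
  refine le_iInf₂ fun l' hl' => ?_
  by_contra! hlt
  have hlt' : l' < l := (ENNReal.ofReal_lt_ofReal_iff_of_nonneg hl'.1.le).1 hlt
  refine (h.trans_le ?_).not_ge hl'.2
  refine setLIntegral_mono' hΩ fun x hx => ENNReal.ofReal_le_ofReal ?_
  refine Real.rpow_le_rpow (abs_nonneg _) ?_ (ha x hx)
  rw [abs_div, abs_div, abs_of_pos hl'.1, abs_of_pos (hl'.1.trans hlt')]
  exact div_le_div_of_nonneg_left (abs_nonneg _) hl'.1 hlt'.le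

lemma memVarLp_of_abs_le (hΩ : MeasurableSet Ω) (hΩb : Bornology.IsBounded Ω)
    {a u : EuclideanSpace ℝ (Fin n) → ℝ} {M R : ℝ} (hu : Measurable u) (hM : 1 ≤ M)
    (huM : ∀ x, |u x| ≤ M) (ha0 : ∀ x ∈ Ω, 0 ≤ a x) (haR : ∀ x ∈ Ω, a x ≤ R) :
    MemVarLp Ω a u := by
  refine ⟨hu.aemeasurable, ?_⟩
  calc varModular Ω a u ≤ ∫⁻ _ in Ω, ENNReal.ofReal (M ^ R) := by
        refine setLIntegral_mono' hΩ fun x hx => ENNReal.ofReal_le_ofReal ?_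
        exact (Real.rpow_le_rpow (abs_nonneg _) (huM x) (ha0 x hx)).trans
          (Real.rpow_le_rpow_of_exponent_le hM (haR x hx))
    _ < ⊤ := by
        rw [setLIntegral_const]
        exact ENNReal.mul_lt_top ENNReal.ofReal_lt_top hΩb.measure_lt_top

end modular

section tentModular

variable {n : ℕ} {Ω : Set (EuclideanSpace ℝ (Fin n))} {x₀ : EuclideanSpace ℝ (Fin n)}
  {β ε : ℝ}

lemma volume_ball_euclideanSpace (x₀ : EuclideanSpace ℝ (Fin n)) (hε : 0 < ε) :
    volume (Metric.ball x₀ ε) = ENNReal.ofReal (ε ^ (n : ℝ)) *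
      volume (Metric.ball (0 : EuclideanSpace ℝ (Fin n)) 1) := by
  rw [Measure.addHaar_ball_of_pos volume x₀ hε, finrank_euclideanSpace_fin, Real.rpow_natCast]

lemma ofReal_rpow_neg_mul_ofReal_rpow (hε : 0 < ε) (a : ℝ) :
    ENNReal.ofReal (ε ^ (-a)) * ENNReal.ofReal (ε ^ a) = 1 := by
  rw [← ENNReal.ofReal_mul (by positivity), ← Real.rpow_add hε, neg_add_cancel, Real.rpow_zero,
    ENNReal.ofReal_one]

lemma varModular_tent_le (hΩ : MeasurableSet Ω) (hε : 0 < ε) (hε1 : ε ≤ 1)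
    {p : EuclideanSpace ℝ (Fin n) → ℝ} (hp0 : ∀ x ∈ Ω, 0 < p x) (hp : ∀ x ∈ Ω, β * p x ≤ n) :
    varModular Ω p (tent x₀ β ε) ≤ volume (Metric.ball (0 : EuclideanSpace ℝ (Fin n)) 1) := by
  calc varModular Ω p (tent x₀ β ε)
      ≤ ∫⁻ x in Ω, (Metric.ball x₀ ε).indicator (fun _ => ENNReal.ofReal (ε ^ (-(n : ℝ)))) x := by
        refine setLIntegral_mono' hΩ fun x hx => ?_
        by_cases hxB : x ∈ Metric.ball x₀ ε
        · rw [Set.indicator_of_mem hxB]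
          refine ENNReal.ofReal_le_ofReal ?_
          rw [abs_of_nonneg (tent_nonneg hε x)]
          calc tent x₀ β ε x ^ p x ≤ (ε ^ (-β)) ^ p x :=
                Real.rpow_le_rpow (tent_nonneg hε x) (tent_le hε x) (hp0 x hx).le
            _ = ε ^ (-β * p x) := by rw [← Real.rpow_mul hε.le]
            _ ≤ _ := Real.rpow_le_rpow_of_exponent_ge hε hε1 (by linarith [hp x hx])
        · simp [tent_eq_zero hε hxB, Real.zero_rpow (hp0 x hx).ne']
    _ ≤ ∫⁻ x, (Metric.ball x₀ ε).indicator (fun _ => ENNReal.ofReal (ε ^ (-(n : ℝ)))) x :=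
        setLIntegral_le_lintegral _ _
    _ = volume (Metric.ball (0 : EuclideanSpace ℝ (Fin n)) 1) := by
        rw [lintegral_indicator_const measurableSet_ball, volume_ball_euclideanSpace x₀ hε,
          ← mul_assoc, ofReal_rpow_neg_mul_ofReal_rpow hε, one_mul]

lemma le_varModular_tent_div (hε : 0 < ε) {r : EuclideanSpace ℝ (Fin n) → ℝ} {ρ l : ℝ}
    (hρ : 0 ≤ ρ) (hBΩ : Metric.ball x₀ (ε / 2) ⊆ Ω) (hr : ∀ x ∈ Metric.ball x₀ (ε / 2), ρ ≤ r x)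
    (hl : 0 < l) (hlε : 1 ≤ ε ^ (-β) / 2 / l) :
    ENNReal.ofReal ((2 * l)⁻¹ ^ ρ * 2⁻¹ ^ (n : ℝ) * ε ^ ((n : ℝ) - β * ρ)) *
      volume (Metric.ball (0 : EuclideanSpace ℝ (Fin n)) 1) ≤
    varModular Ω r (fun x => tent x₀ β ε x / l) := by
  calc ENNReal.ofReal ((2 * l)⁻¹ ^ ρ * 2⁻¹ ^ (n : ℝ) * ε ^ ((n : ℝ) - β * ρ)) *
      volume (Metric.ball (0 : EuclideanSpace ℝ (Fin n)) 1)
      = ∫⁻ _ in Metric.ball x₀ (ε / 2), ENNReal.ofReal ((ε ^ (-β) / 2 / l) ^ ρ) := by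
        rw [setLIntegral_const, volume_ball_euclideanSpace x₀ (half_pos hε), ← mul_assoc,
          ← ENNReal.ofReal_mul (by positivity)]
        congr 2
        rw [div_div, div_eq_inv_mul, Real.mul_rpow (by positivity) (by positivity),
          ← Real.rpow_mul hε.le, div_eq_inv_mul ε, Real.mul_rpow (by positivity) hε.le,
          sub_eq_neg_add, Real.rpow_add hε, neg_mul]
        ring
    _ ≤ ∫⁻ x in Metric.ball x₀ (ε / 2), ENNReal.ofReal (|tent x₀ β ε x / l| ^ r x) := by
        refine setLIntegral_mono' measurableSet_ball fun x hx => ENNReal.ofReal_le_ofReal ?_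
        rw [abs_of_nonneg (div_nonneg (tent_nonneg hε x) hl.le)]
        calc (ε ^ (-β) / 2 / l) ^ ρ ≤ (ε ^ (-β) / 2 / l) ^ r x :=
              Real.rpow_le_rpow_of_exponent_le hlε (hr x hx)
          _ ≤ _ := by
              refine Real.rpow_le_rpow (by positivity) ?_ (hρ.trans (hr x hx))
              gcongr
              exact le_tent hε hx
    _ ≤ varModular Ω r (fun x => tent x₀ β ε x / l) := lintegral_mono_set hBΩ

lemma tendsto_luxNorm_tent (hΩ : MeasurableSet Ω) {r : EuclideanSpace ℝ (Fin n) → ℝ} {ρ δ : ℝ}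
    (hρ : 0 ≤ ρ) (hδ : 0 < δ) (hBΩ : Metric.ball x₀ δ ⊆ Ω) (hr0 : ∀ x ∈ Ω, 0 ≤ r x)
    (hr : ∀ x ∈ Metric.ball x₀ δ, ρ ≤ r x) (hβ : 0 < β) (hβρ : n < β * ρ) :
    Tendsto (fun ε => luxNorm Ω r (tent x₀ β ε)) (𝓝[>] 0) (𝓝 ⊤) := by
  rw [ENNReal.tendsto_nhds_top_iff_nnreal]
  intro N
  set l : ℝ := N + 1
  have hl : 0 < l := by positivity
  have hv : 0 < volume (Metric.ball (0 : EuclideanSpace ℝ (Fin n)) 1) :=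
    Metric.measure_ball_pos _ _ one_pos
  have h1 : Tendsto (fun ε : ℝ => ε ^ (-β) / 2 / l) (𝓝[>] 0) atTop :=
    ((tendsto_rpow_neg_nhdsGT_zero (by linarith)).atTop_div_const two_pos).atTop_div_const hl
  have h2 : Tendsto (fun ε : ℝ => (2 * l)⁻¹ ^ ρ * 2⁻¹ ^ (n : ℝ) * ε ^ ((n : ℝ) - β * ρ))
      (𝓝[>] 0) atTop :=
    (tendsto_rpow_neg_nhdsGT_zero (by linarith)).const_mul_atTop (by positivity)
  have h3 : Tendsto (fun ε : ℝ =>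
      ENNReal.ofReal ((2 * l)⁻¹ ^ ρ * 2⁻¹ ^ (n : ℝ) * ε ^ ((n : ℝ) - β * ρ)) *
        volume (Metric.ball (0 : EuclideanSpace ℝ (Fin n)) 1)) (𝓝[>] 0) (𝓝 ⊤) := by
    have := ENNReal.Tendsto.mul_const (ENNReal.tendsto_ofReal_atTop.comp h2)
      (b := volume (Metric.ball (0 : EuclideanSpace ℝ (Fin n)) 1)) (Or.inl ENNReal.top_ne_zero)
    rwa [ENNReal.top_mul hv.ne'] at this
  filter_upwards [h1.eventually_ge_atTop 1, h3.eventually_const_lt ENNReal.one_lt_top,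
    self_mem_nhdsWithin, Ioo_mem_nhdsGT hδ] with ε hε1 hε2 hε hεδ
  have hε' : 0 < ε := hε
  have hsub : Metric.ball x₀ (ε / 2) ⊆ Metric.ball x₀ δ :=
    Metric.ball_subset_ball (by linarith [hεδ.2])
  refine lt_of_lt_of_le ?_ (le_luxNorm_of_one_lt_varModular (l := l) hΩ hr0
    (hε2.trans_le (le_varModular_tent_div hε' hρ (hsub.trans hBΩ) (fun x hx => hr x (hsub hx))
      hl hε1)))
  rw [← ENNReal.ofReal_coe_nnreal]
  exact (ENNReal.ofReal_lt_ofReal_iff hl).2 (by simp [l])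

lemma gagModular_tent_le (hΩ : MeasurableSet Ω) {δ κ Q : ℝ}
    {q s : EuclideanSpace ℝ (Fin n) → EuclideanSpace ℝ (Fin n) → ℝ}
    (hε : 0 < ε) (hεδ : ε ≤ δ / 2) (hδ1 : δ ≤ 1) (hκ : 0 ≤ κ)
    (hs0 : ∀ x y, 0 ≤ s x y) (hs1 : ∀ x y, s x y ≤ 1)
    (hq1 : ∀ x ∈ Ω, ∀ y ∈ Ω, 1 ≤ q x y) (hqQ : ∀ x ∈ Ω, ∀ y ∈ Ω, q x y ≤ Q)
    (hβq : ∀ x ∈ Ω, ∀ y ∈ Ω, β * q x y ≤ n)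
    (hκs : ∀ x ∈ Metric.ball x₀ δ, ∀ y ∈ Metric.ball x₀ δ, κ ≤ s x y)
    (hκs' : ∀ x ∈ Metric.ball x₀ δ, ∀ y ∈ Metric.ball x₀ δ, κ ≤ 1 - s x y)
    (hβqs : ∀ x ∈ Ω ∩ Metric.ball x₀ δ, ∀ y ∈ Ω ∩ Metric.ball x₀ δ,
      β * q x y + q x y * s x y ≤ n) :
    gagModular Ω q s (tent x₀ β ε) ≤
      2 * (volume (Metric.ball (0 : EuclideanSpace ℝ (Fin n)) 1) *
        ((∫⁻ w : EuclideanSpace ℝ (Fin n), ENNReal.ofReal (radialKernel n κ ‖w‖)) +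
          ENNReal.ofReal ((δ / 2) ^ (-((n : ℝ) + Q))) * volume Ω)) := by
  set L := ∫⁻ w : EuclideanSpace ℝ (Fin n), ENNReal.ofReal (radialKernel n κ ‖w‖)
  set B := Metric.ball x₀ ε
  have hδ : 0 < δ := by linarith
  have hε1 : ε ≤ 1 := by linarith
  set G : EuclideanSpace ℝ (Fin n) → EuclideanSpace ℝ (Fin n) → ℝ≥0∞ := fun x y =>
    ENNReal.ofReal (ε ^ (-(2 * n : ℝ))) * ENNReal.ofReal (radialKernel n κ (dist x y / ε)) +
      ENNReal.ofReal (ε ^ (-(n : ℝ)) * (δ / 2) ^ (-((n : ℝ) + Q))) with hG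
  have hGsymm : ∀ x y, G x y = G y x := fun x y => by simp only [hG, dist_comm]
  have hGm : Measurable (Function.uncurry G) := by
    have := measurable_radialKernel n κ
    simp only [hG, Function.uncurry_def]
    fun_prop
  set H : EuclideanSpace ℝ (Fin n) → EuclideanSpace ℝ (Fin n) → ℝ≥0∞ := fun x y =>
    B.indicator (fun x => G x y) x with hH
  have hHm : Measurable (Function.uncurry H) := by
    have : Function.uncurry H = (B ×ˢ Set.univ).indicator (Function.uncurry G) := by
      ext ⟨x, y⟩
      by_cases hx : x ∈ B <;> simp [hH, hx]
    rw [this]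
    exact hGm.indicator (measurableSet_ball.prod MeasurableSet.univ)
  have hpt : ∀ x ∈ Ω, ∀ y ∈ Ω, (x ∈ B ∨ y ∈ B) →
      ENNReal.ofReal (|tent x₀ β ε x - tent x₀ β ε y| ^ q x y /
        dist x y ^ ((n : ℝ) + q x y * s x y)) ≤ G x y := by
    intro x hx y hy hxy
    have hq := hq1 x hx y hy
    by_cases hnear : x ∈ Metric.ball x₀ δ ∧ y ∈ Metric.ball x₀ δ
    · refine le_trans ?_ le_self_add
      rw [← ENNReal.ofReal_mul (by positivity)]
      refine ENNReal.ofReal_le_ofReal ?_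
      rcases eq_or_ne x y with rfl | hne
      · rw [sub_self, abs_zero, Real.zero_rpow (by linarith), zero_div]
        simp only [radialKernel]
        positivity
      · exact rpow_div_rpow_le_near hε hε1 hκ (hκs x hnear.1 y hnear.2)
          (hκs' x hnear.1 y hnear.2) hq (hβqs x ⟨hx, hnear.1⟩ y ⟨hy, hnear.2⟩)
          (dist_pos.2 hne) (abs_nonneg _) (abs_tent_sub_tent_le hε x y)
    · refine le_trans (ENNReal.ofReal_le_ofReal ?_) le_add_self
      refine rpow_div_rpow_le_far hε hε1 (half_pos hδ) (by linarith) (hs0 x y) (hs1 x y)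
        (by linarith) (hqQ x hx y hy) (hβq x hx y hy) ?_ (abs_nonneg _)
        ((abs_tent_sub_tent_le hε x y).trans ?_)
      · rw [not_and_or] at hnear
        simp only [Metric.mem_ball, not_lt, B] at hnear hxy
        have t1 := dist_triangle x y x₀
        have t2 := dist_triangle_left y x₀ x
        rcases hnear with h | h <;> rcases hxy with h' | h' <;> linarith
      · exact mul_le_of_le_one_right (by positivity) (min_le_left _ _)
  have hHint : ∫⁻ x in Ω, ∫⁻ y in Ω, H x y ≤
      volume (Metric.ball (0 : EuclideanSpace ℝ (Fin n)) 1) *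
        (L + ENNReal.ofReal ((δ / 2) ^ (-((n : ℝ) + Q))) * volume Ω) := by
    have hinner : ∀ x, ∫⁻ y in Ω, G x y ≤ ENNReal.ofReal (ε ^ (-(n : ℝ))) *
        (L + ENNReal.ofReal ((δ / 2) ^ (-((n : ℝ) + Q))) * volume Ω) := by
      intro x
      simp only [hG]
      rw [lintegral_add_right _ measurable_const, setLIntegral_const, mul_add,
        lintegral_const_mul' _ _ ENNReal.ofReal_ne_top,
        ENNReal.ofReal_mul (p := ε ^ (-(n : ℝ))) (by positivity), mul_assoc]
      gcongr ?_ + _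
      calc ENNReal.ofReal (ε ^ (-(2 * n : ℝ))) *
            ∫⁻ y in Ω, ENNReal.ofReal (radialKernel n κ (dist x y / ε))
          ≤ ENNReal.ofReal (ε ^ (-(2 * n : ℝ))) * (ENNReal.ofReal (ε ^ (n : ℝ)) * L) := by
            gcongr
            rw [← lintegral_radialKernel_dist κ x hε]
            exact setLIntegral_le_lintegral _ _
        _ = ENNReal.ofReal (ε ^ (-(n : ℝ))) * L := by
            rw [← mul_assoc, ← ENNReal.ofReal_mul (by positivity), ← Real.rpow_add hε]
            congr 3
            ring
    calc ∫⁻ x in Ω, ∫⁻ y in Ω, H x y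
        ≤ ∫⁻ x in Ω, B.indicator (fun _ => ENNReal.ofReal (ε ^ (-(n : ℝ))) *
            (L + ENNReal.ofReal ((δ / 2) ^ (-((n : ℝ) + Q))) * volume Ω)) x := by
          refine lintegral_mono fun x => ?_
          by_cases hx : x ∈ B
          · simpa [hH, hx] using hinner x
          · simp [hH, hx]
      _ ≤ ∫⁻ x, B.indicator (fun _ => ENNReal.ofReal (ε ^ (-(n : ℝ))) *
            (L + ENNReal.ofReal ((δ / 2) ^ (-((n : ℝ) + Q))) * volume Ω)) x :=
          setLIntegral_le_lintegral _ _
      _ = _ := by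
          rw [lintegral_indicator_const measurableSet_ball, volume_ball_euclideanSpace x₀ hε,
            mul_right_comm, ← mul_assoc, ofReal_rpow_neg_mul_ofReal_rpow hε, one_mul]
  have hswap : ∫⁻ x in Ω, ∫⁻ y in Ω, H y x = ∫⁻ x in Ω, ∫⁻ y in Ω, H x y :=
    (lintegral_lintegral_swap hHm.aemeasurable).symm
  calc gagModular Ω q s (tent x₀ β ε)
      ≤ ∫⁻ x in Ω, ∫⁻ y in Ω, (H x y + H y x) := by
        refine setLIntegral_mono' hΩ fun x hx => setLIntegral_mono' hΩ fun y hy => ?_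
        by_cases hxB : x ∈ B
        · refine (hpt x hx y hy (Or.inl hxB)).trans (le_trans (le_of_eq ?_) le_self_add)
          simp [hH, hxB]
        · by_cases hyB : y ∈ B
          · refine (hpt x hx y hy (Or.inr hyB)).trans (le_trans (le_of_eq ?_) le_add_self)
            simp [hH, hyB, hGsymm x y]
          · have := hq1 x hx y hy
            rw [tent_eq_zero hε hxB, tent_eq_zero hε hyB, sub_self, abs_zero,
              Real.zero_rpow (by linarith), zero_div, ENNReal.ofReal_zero]
            exact zero_le
    _ = (∫⁻ x in Ω, ∫⁻ y in Ω, H x y) + ∫⁻ x in Ω, ∫⁻ y in Ω, H y x := by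
        have hHi : Measurable fun x => ∫⁻ y in Ω, H x y := hHm.lintegral_prod_right
        rw [← lintegral_add_left hHi]
        refine lintegral_congr fun x => ?_
        exact lintegral_add_left (hHm.comp measurable_prodMk_left) _
    _ ≤ _ := by
        rw [hswap, ← two_mul]
        gcongr

end tentModular

lemma not_h0EmbedsInVarLp_of_tendsto {n : ℕ} {Ω : Set (EuclideanSpace ℝ (Fin n))}
    {p r : EuclideanSpace ℝ (Fin n) → ℝ}
    {q s : EuclideanSpace ℝ (Fin n) → EuclideanSpace ℝ (Fin n) → ℝ} {C : ℝ}
    {u : ℕ → EuclideanSpace ℝ (Fin n) → ℝ} (hu : ∀ j, MemH0 Ω p q s (u j))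
    (hC : ∀ j, h0Norm Ω p q s (u j) ≤ ENNReal.ofReal C)
    (hr : Tendsto (fun j => luxNorm Ω r (u j)) atTop (𝓝 ⊤)) : ¬ H0EmbedsInVarLp Ω p q s r := by
  rintro ⟨K, -, hK⟩
  have hlt : ENNReal.ofReal K * ENNReal.ofReal C < ⊤ :=
    ENNReal.mul_lt_top ENNReal.ofReal_lt_top ENNReal.ofReal_lt_top
  obtain ⟨j, hj⟩ := (hr.eventually_const_lt hlt).exists
  refine hj.not_ge ((hK _ (hu j)).2.trans ?_)
  gcongr
  exact hC j

/-- Near a point where `n q / (n - s q) < ρ` the supercritical inequality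
`(n / ρ) q + q s ≤ n` persists, and `s` stays away from `0` and `1`. -/
lemma exists_radius_supercritical {n : ℕ} {Ω : Set (EuclideanSpace ℝ (Fin n))} (hΩo : IsOpen Ω)
    {q s : EuclideanSpace ℝ (Fin n) → EuclideanSpace ℝ (Fin n) → ℝ}
    (hqc : ContinuousOn (fun z : EuclideanSpace ℝ (Fin n) × EuclideanSpace ℝ (Fin n) =>
      q z.1 z.2) (closure Ω ×ˢ closure Ω))
    (hsc : Continuous fun z : EuclideanSpace ℝ (Fin n) × EuclideanSpace ℝ (Fin n) => s z.1 z.2)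
    {r : EuclideanSpace ℝ (Fin n) → ℝ} (hrc : ContinuousOn r (closure Ω))
    {x₀ : EuclideanSpace ℝ (Fin n)} (hx₀ : x₀ ∈ Ω) {κ ρ : ℝ} (hκs : κ < s x₀ x₀)
    (hκs' : κ < 1 - s x₀ x₀) (hρ : 0 < ρ) (hsq : s x₀ x₀ * q x₀ x₀ < n)
    (hsup : (n : ℝ) * q x₀ x₀ / ((n : ℝ) - s x₀ x₀ * q x₀ x₀) < ρ) (hρr : ρ < r x₀) :
    ∃ δ : ℝ, 0 < δ ∧ δ ≤ 1 ∧ Metric.closedBall x₀ δ ⊆ Ω ∧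
      (∀ x ∈ Metric.closedBall x₀ δ, ρ < r x) ∧
      ∀ x ∈ Metric.ball x₀ δ, ∀ y ∈ Metric.ball x₀ δ,
        κ ≤ s x y ∧ κ ≤ 1 - s x y ∧ n / ρ * q x y + q x y * s x y ≤ n := by
  have hΩ' : Ω ∈ 𝓝 x₀ := hΩo.mem_nhds hx₀
  have hcl : closure Ω ∈ 𝓝 x₀ := mem_of_superset hΩ' subset_closure
  have hqat := hqc.continuousAt (x := (x₀, x₀)) (prod_mem_nhds hcl hcl)
  have hsat := hsc.continuousAt (x := (x₀, x₀))
  have hf : n / ρ * q x₀ x₀ + q x₀ x₀ * s x₀ x₀ < n := by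
    rw [div_lt_iff₀ (by linarith)] at hsup
    have : n / ρ * q x₀ x₀ < n - s x₀ x₀ * q x₀ x₀ := by
      rw [div_mul_eq_mul_div, div_lt_iff₀ hρ]
      linarith
    linarith
  have e1 := ((continuousAt_const (y := (n : ℝ) / ρ)).mul hqat).add (hqat.mul hsat)
    |>.eventually_lt_const hf
  have e2 := hsat.eventually_const_lt hκs
  have e3 := ((continuousAt_const (y := (1 : ℝ))).sub hsat).eventually_const_lt hκs'
  have e4 := (hrc.continuousAt hcl).eventually_const_lt hρr
  obtain ⟨δ₁, hδ₁, h₁⟩ := Metric.eventually_nhds_iff_ball.1 ((e1.and e2).and e3)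
  obtain ⟨δ₂, hδ₂, h₂⟩ := Metric.eventually_nhds_iff_ball.1 (e4.and hΩ')
  have hmem : ∀ x ∈ Metric.closedBall x₀ (min (min δ₁ (δ₂ / 2)) 1), x ∈ Metric.ball x₀ δ₂ :=
    fun x hx => Metric.closedBall_subset_ball
      ((min_le_left _ _).trans_lt ((min_le_right _ _).trans_lt (by linarith))) hx
  refine ⟨min (min δ₁ (δ₂ / 2)) 1, by positivity, min_le_right _ _,
    fun x hx => (h₂ x (hmem x hx)).2, fun x hx => (h₂ x (hmem x hx)).1, fun x hx y hy => ?_⟩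
  have hsub : Metric.ball x₀ (min (min δ₁ (δ₂ / 2)) 1) ⊆ Metric.ball x₀ δ₁ :=
    Metric.ball_subset_ball ((min_le_left _ _).trans (min_le_left _ _))
  have h := h₁ (x, y) (by rw [← ball_prod_same]; exact ⟨hsub hx, hsub hy⟩)
  exact ⟨h.1.2.le, h.2.le, h.1.1.le⟩

theorem statement6 {n : ℕ} (hn : 1 ≤ n)
    (Ω : Set (EuclideanSpace ℝ (Fin n))) (hΩo : IsOpen Ω) (hΩb : Bornology.IsBounded Ω)
    (q s : EuclideanSpace ℝ (Fin n) → EuclideanSpace ℝ (Fin n) → ℝ)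
    (hqc : ContinuousOn (fun z : EuclideanSpace ℝ (Fin n) × EuclideanSpace ℝ (Fin n) =>
      q z.1 z.2) (closure Ω ×ˢ closure Ω))
    (hq1 : ∀ x ∈ closure Ω, ∀ y ∈ closure Ω, 1 < q x y)
    (hqsym : ∀ x ∈ closure Ω, ∀ y ∈ closure Ω, q x y = q y x)
    (hsc : Continuous fun z : EuclideanSpace ℝ (Fin n) × EuclideanSpace ℝ (Fin n) => s z.1 z.2)
    (hs01 : ∀ x y, 0 < s x y ∧ s x y < 1)
    (hssym : ∀ x y, s x y = s y x)
    (r : EuclideanSpace ℝ (Fin n) → ℝ) (hrc : ContinuousOn r (closure Ω))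
    (hr1 : ∀ x ∈ closure Ω, 1 < r x)
    (x₀ : EuclideanSpace ℝ (Fin n)) (hx₀ : x₀ ∈ Ω)
    (hsq : s x₀ x₀ * q x₀ x₀ < n)
    (hsup : (n : ℝ) * q x₀ x₀ / ((n : ℝ) - s x₀ x₀ * q x₀ x₀) < r x₀)
    (hqr : ∀ x ∈ closure Ω, ∀ y ∈ closure Ω, q x y < r x₀) :
    ∃ δ : ℝ, 0 < δ ∧ Metric.closedBall x₀ δ ⊆ Ω ∧
      (∃ p : EuclideanSpace ℝ (Fin n) → ℝ, ContinuousOn p (closure Ω) ∧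
        (∀ x ∈ closure Ω, 1 < p x) ∧
        (∀ x ∈ closure Ω, ∀ y ∈ Metric.closedBall x₀ δ, p x < r y) ∧
        (∀ x ∈ closure Ω, ∀ y ∈ closure Ω, ∀ z ∈ closure Ω, q x y < p z)) ∧
      ∀ p : EuclideanSpace ℝ (Fin n) → ℝ, ContinuousOn p (closure Ω) →
        (∀ x ∈ closure Ω, 1 < p x) →
        (∀ x ∈ closure Ω, ∀ y ∈ Metric.closedBall x₀ δ, p x < r y) →
        (∃ C : ℝ, 0 < C ∧ ∃ u : ℕ → EuclideanSpace ℝ (Fin n) → ℝ,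
          (∀ j, MemH0 Ω p q s (u j) ∧ MemVarLp Ω r (u j) ∧
            tsupport (u j) ⊆ Metric.ball x₀ δ) ∧
          (∀ j, h0Norm Ω p q s (u j) ≤ ENNReal.ofReal C) ∧
          Tendsto (fun j => luxNorm Ω r (u j)) atTop (𝓝 ⊤)) ∧
        ¬ H0EmbedsInVarLp Ω p q s r := by
  have hΩm : MeasurableSet Ω := hΩo.measurableSet
  have hK : IsCompact (closure Ω) := hΩb.isCompact_closure
  have hxc : x₀ ∈ closure Ω := subset_closure hx₀
  have hne : (closure Ω).Nonempty := ⟨x₀, hxc⟩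
  have hn0 : (0 : ℝ) < n := by exact_mod_cast hn
  obtain ⟨z, hz, hzmax⟩ := (hK.prod hK).exists_isMaxOn (hne.prod hne) hqc
  obtain ⟨Q, hQr, hqQ⟩ : ∃ Q, Q < r x₀ ∧ ∀ x ∈ closure Ω, ∀ y ∈ closure Ω, q x y ≤ Q :=
    ⟨q z.1 z.2, hqr _ hz.1 _ hz.2, fun x hx y hy => hzmax (Set.mk_mem_prod hx hy)⟩
  obtain ⟨R, hR⟩ := hK.bddAbove_image hrc
  have hR' : ∀ x ∈ Ω, r x ≤ R := fun x hx => hR (Set.mem_image_of_mem r (subset_closure hx))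
  obtain ⟨ρ, hρ, hρr⟩ := exists_between (max_lt hQr hsup)
  obtain ⟨hQρ, hρsup⟩ := max_lt_iff.1 hρ
  have hρ1 : 1 < ρ := ((hq1 _ hxc _ hxc).trans_le (hqQ _ hxc _ hxc)).trans hQρ
  have hρ0 : 0 < ρ := by linarith
  have hs₀ := hs01 x₀ x₀
  obtain ⟨κ, hκ, hκs⟩ := exists_between (lt_min hs₀.1 (sub_pos.2 hs₀.2))
  obtain ⟨hκs, hκs'⟩ := lt_min_iff.1 hκs
  obtain ⟨δ, hδ, hδ1, hδΩ, hδr, hδs⟩ := exists_radius_supercritical hΩo hqc hsc hrc hx₀ hκs hκs'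
    hρ0 hsq hρsup hρr
  refine ⟨δ, hδ, hδΩ, ⟨fun _ => ρ, continuousOn_const, fun _ _ => hρ1, fun _ _ => hδr,
    fun x hx y hy _ _ => (hqQ x hx y hy).trans_lt hQρ⟩, fun p hpc hp1 hpr => ?_⟩
  obtain ⟨x₁, hx₁, hx₁max⟩ := hK.exists_isMaxOn hne hpc
  obtain ⟨y₁, hy₁, hy₁min⟩ := (isCompact_closedBall x₀ δ).exists_isMinOn
    ⟨x₀, Metric.mem_closedBall_self hδ.le⟩ (hrc.mono (hδΩ.trans subset_closure))
  set μ := max ρ (p x₁)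
  have hμ0 : 0 < μ := hρ0.trans_le (le_max_left _ _)
  have hμr : μ < r y₁ := max_lt (hδr y₁ hy₁) (hpr x₁ hx₁ y₁ hy₁)
  set β := n / μ
  have hβ : 0 < β := by positivity
  have hβρ : β ≤ n / ρ := div_le_div_of_nonneg_left hn0.le hρ0 (le_max_left _ _)
  have hβle : ∀ t, t ≤ μ → β * t ≤ n := fun t ht => by
    rw [div_mul_eq_mul_div, div_le_iff₀ hμ0]
    gcongr
  have hq1' : ∀ x ∈ Ω, ∀ y ∈ Ω, 1 ≤ q x y := fun x hx y hy =>
    (hq1 x (subset_closure hx) y (subset_closure hy)).le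
  have hqQ' : ∀ x ∈ Ω, ∀ y ∈ Ω, q x y ≤ Q := fun x hx y hy =>
    hqQ x (subset_closure hx) y (subset_closure hy)
  have hp1' : ∀ x ∈ Ω, 1 ≤ p x := fun x hx => (hp1 x (subset_closure hx)).le
  have hr0 : ∀ x ∈ Ω, 0 ≤ r x := fun x hx => by linarith [hr1 x (subset_closure hx)]
  set v := volume (Metric.ball (0 : EuclideanSpace ℝ (Fin n)) 1)
  have hv : v ≠ ⊤ := measure_ball_lt_top.ne
  set A := 2 * (v * ((∫⁻ w : EuclideanSpace ℝ (Fin n), ENNReal.ofReal (radialKernel n κ ‖w‖)) +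
    ENNReal.ofReal ((δ / 2) ^ (-((n : ℝ) + Q))) * volume Ω))
  have hA : A ≠ ⊤ := by
    refine ENNReal.mul_ne_top ENNReal.ofNat_ne_top (ENNReal.mul_ne_top hv
      (ENNReal.add_ne_top.2 ⟨(lintegral_radialKernel_lt_top hn hκ).ne, ?_⟩))
    exact ENNReal.mul_ne_top ENNReal.ofReal_ne_top hΩb.measure_lt_top.ne
  set ε : ℕ → ℝ := fun j => δ / 2 / (j + 1)
  have hε0 : ∀ j, 0 < ε j := fun j => by positivity
  have hεδ : ∀ j, ε j ≤ δ / 2 := fun j =>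
    div_le_self (by positivity) (by linarith [(Nat.cast_nonneg j : (0 : ℝ) ≤ j)])
  have hε1 : ∀ j, ε j ≤ 1 := fun j => by linarith [hεδ j]
  have hεlim : Tendsto ε atTop (𝓝[>] 0) := by
    refine tendsto_nhdsWithin_iff.2 ⟨?_, Eventually.of_forall hε0⟩
    exact tendsto_const_nhds.div_atTop
      (tendsto_atTop_add_const_right _ _ tendsto_natCast_atTop_atTop)
  have hvarp : ∀ j, varModular Ω p (tent x₀ β (ε j)) ≤ v := fun j =>
    varModular_tent_le hΩm (hε0 j) (hε1 j) (fun x hx => by linarith [hp1' x hx])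
      fun x hx => hβle _ ((hx₁max (subset_closure hx)).trans (le_max_right _ _))
  have hlux : ∀ j, luxNorm Ω p (tent x₀ β (ε j)) ≤ ENNReal.ofReal (v.toReal + 1) := fun j =>
    luxNorm_le_of_varModular_le hΩm hp1' ENNReal.toReal_nonneg
      (by rw [ENNReal.ofReal_toReal hv]; exact hvarp j)
  have hgag : ∀ j, gagSemi Ω q s (tent x₀ β (ε j)) ≤ ENNReal.ofReal (A.toReal + 1) := fun j => by
    refine gagSemi_le_of_gagModular_le hΩm hq1' ENNReal.toReal_nonneg ?_
    rw [ENNReal.ofReal_toReal hA]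
    refine gagModular_tent_le hΩm (hε0 j) (hεδ j) hδ1 hκ.le (fun x y => (hs01 x y).1.le)
      (fun x y => (hs01 x y).2.le) hq1' hqQ'
      (fun x hx y hy => hβle _ (((hqQ' x hx y hy).trans hQρ.le).trans (le_max_left _ _)))
      (fun x hx y hy => (hδs x hx y hy).1) (fun x hx y hy => (hδs x hx y hy).2.1)
      fun x hx y hy => ?_
    have hq := hq1' x hx.1 y hy.1
    refine le_trans ?_ (hδs x hx.2 y hy.2).2.2
    gcongr
  have hmem : ∀ j, MemH0 Ω p q s (tent x₀ β (ε j)) := fun j => by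
    refine ⟨continuous_tent.measurable.aemeasurable, Eventually.of_forall fun x hx => ?_,
      ⟨continuous_tent.measurable.aemeasurable, (hvarp j).trans_lt hv.lt_top⟩,
      (hgag j).trans_lt ENNReal.ofReal_lt_top⟩
    refine tent_eq_zero (hε0 j) fun hxB => hx (hδΩ ?_)
    exact Metric.ball_subset_closedBall (Metric.ball_subset_ball (by linarith [hεδ j]) hxB)
  have hmemr : ∀ j, MemVarLp Ω r (tent x₀ β (ε j)) := fun j =>
    memVarLp_of_abs_le hΩm hΩb continuous_tent.measurable
      (Real.one_le_rpow_of_pos_of_le_one_of_nonpos (hε0 j) (hε1 j)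
        (neg_nonpos.2 hβ.le))
      (fun x => by rw [abs_of_nonneg (tent_nonneg (hε0 j) x)]; exact tent_le (hε0 j) x) hr0 hR'
  have hnorm : ∀ j, h0Norm Ω p q s (tent x₀ β (ε j)) ≤
      ENNReal.ofReal (v.toReal + 1 + (A.toReal + 1)) := fun j => by
    rw [ENNReal.ofReal_add (by positivity) (by positivity)]
    exact add_le_add (hlux j) (hgag j)
  have hβr : n < β * r y₁ := by
    rw [div_mul_eq_mul_div, lt_div_iff₀ hμ0]
    gcongr
  have hlim : Tendsto (fun j => luxNorm Ω r (tent x₀ β (ε j))) atTop (𝓝 ⊤) :=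
    (tendsto_luxNorm_tent hΩm (hμ0.trans hμr).le hδ (Metric.ball_subset_closedBall.trans hδΩ) hr0
      (fun x hx => hy₁min (Metric.ball_subset_closedBall hx)) hβ hβr).comp hεlim
  exact ⟨⟨_, by positivity, fun j => tent x₀ β (ε j), fun j => ⟨hmem j, hmemr j,
    tsupport_tent_subset (hε0 j) (by linarith [hεδ j])⟩, hnorm, hlim⟩,
    not_h0EmbedsInVarLp_of_tendsto hmem hnorm hlim⟩
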